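/- Let β ∈ (0, 1/2^{|S|}), a > 0 and ε ∈ (0, (1/2)·(a/L)^{|S|}·β(1−β)/(L·|S|⁴)). Let q be an irreducible transition matrix on S satisfying the mixing hypothesis with parameter a on S₁. Let q̂ be a transition matrix that is (ε,β)-close to q on S₁ and coincides with q on S\S₁ (i.e. q̂(t|s) = q(t|s) for every s ∉ S₁ and every t ∈ S). Then there exists a recurrent class R for q̂ with S₁ ⊆ R. -/

import Mathlib

open Finset

namespace PerturbedMC

variable {S : Type*} [Fintype S] [DecidableEq S]

/-- `q` is a (row-stochastic) transition matrix on `S`: `q s t` is the probability of moving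
from `s` to `t`. -/
def IsTransition (q : Matrix S S ℝ) : Prop :=
  (∀ s t, 0 ≤ q s t) ∧ ∀ s, ∑ t, q s t = 1

/-- `q` is irreducible. -/
def IsIrreducible (q : Matrix S S ℝ) : Prop :=
  ∀ s t, ∃ n : ℕ, 1 ≤ n ∧ 0 < (q ^ n) s t

/-- `μ` is a stationary distribution of `q`. -/
def IsStationary (q : Matrix S S ℝ) (μ : S → ℝ) : Prop :=
  (∀ s, 0 ≤ μ s) ∧ (∑ s, μ s = 1) ∧ ∀ t, ∑ s, μ s * q s t = μ t

/-- The combinatorial constant `L = ∑_{n=1}^{|S|-1} C(|S|,n) · n^{|S|}`. -/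
def Lconst (S : Type*) [Fintype S] : ℕ :=
  ∑ n ∈ Finset.Ico 1 (Fintype.card S), (Fintype.card S).choose n * n ^ Fintype.card S

/-- `ζ_q`: the minimal stationary outflow over nonempty proper subsets of `S`. -/
noncomputable def zeta (q : Matrix S S ℝ) (μ : S → ℝ) : ℝ :=
  sInf {x : ℝ | ∃ C : Finset S, C.Nonempty ∧ C ≠ Finset.univ ∧
    x = ∑ s ∈ C, μ s * ∑ t ∈ Cᶜ, q s t}

/-- `ζ_q^1`: the minimal stationary outflow over nonempty proper subsets of `S₁`. -/
noncomputable def zeta1 (q : Matrix S S ℝ) (μ : S → ℝ) (S1 : Finset S) : ℝ :=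
  sInf {x : ℝ | ∃ C : Finset S, C.Nonempty ∧ C ⊂ S1 ∧
    x = ∑ s ∈ C, μ s * ∑ t ∈ Cᶜ, q s t}

/-- `q̂` is `(ε,β)`-close to `q`, relative to the threshold `z` (`z = ζ_q` or `z = ζ_q^1`):
`|q̂(t|s) − q(t|s)| ≤ β·q(t|s)` whenever `μ_s q(t|s) ≥ ε·z` or `μ_s q̂(t|s) ≥ ε·z`. -/
def IsClose (q qh : Matrix S S ℝ) (μ : S → ℝ) (z ε β : ℝ) : Prop :=
  ∀ s t, (ε * z ≤ μ s * q s t ∨ ε * z ≤ μ s * qh s t) → |qh s t - q s t| ≤ β * q s t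

/-- The substochastic `C × C` restriction `q_C` of `q`. -/
def subMat (q : Matrix S S ℝ) (C : Finset S) : Matrix S S ℝ :=
  fun u v => if u ∈ C ∧ v ∈ C then q u v else 0

/-- The exit distribution `Q_{s,q}(t|C) = Σ_{n≥0} Σ_{u∈C} (q_C^n)(u|s)·q(t|u)`. -/
noncomputable def exitProb (q : Matrix S S ℝ) (C : Finset S) (s t : S) : ℝ :=
  ∑' n : ℕ, ∑ u ∈ C, ((subMat q C ^ n : Matrix S S ℝ) s u) * q u t

/-- The expected exit time `E_{s,q}[T_{C̄}] = Σ_{n≥0} Σ_{u∈C} (q_C^n)(u|s) ∈ [0,∞]`. -/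
noncomputable def expExit (q : Matrix S S ℝ) (C : Finset S) (s : S) : ENNReal :=
  ∑' n : ℕ, ENNReal.ofReal (∑ u ∈ C, (subMat q C ^ n : Matrix S S ℝ) s u)

/-- `g` has a cycle within `C`. -/
def HasCycle (C : Finset S) (g : S → S) : Prop :=
  ∃ (k : ℕ) (f : ℕ → S), 0 < k ∧ f k = f 0 ∧ (∀ i < k, f i ∈ C) ∧ ∀ i < k, g (f i) = f (i + 1)

/-- `g` is a `C`-graph (the values of `g` outside `C` are irrelevant). -/
def IsCGraph (C : Finset S) (g : S → S) : Prop := ¬ HasCycle C g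

/-- `s` leads to `t` along `g`: `t` is the first state outside `C` on the `g`-orbit of `s`. -/
def LeadsTo (C : Finset S) (g : S → S) (s t : S) : Prop :=
  ∃ n : ℕ, g^[n] s = t ∧ t ∉ C ∧ ∀ m < n, g^[m] s ∈ C

/-- The weight `p(g) = Π_{s∈C} q(g(s)|s)` of a `C`-graph under `q`. -/
def wt (q : Matrix S S ℝ) (C : Finset S) (g : S → S) : ℝ := ∏ s ∈ C, q s (g s)

/-- `G(C)`: the canonical representatives of `C`-graphs, namely the maps `S → S` that are
`C`-graphs and are the identity outside `C`. -/
noncomputable def Gset (C : Finset S) : Finset (S → S) :=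
  @Finset.filter _ (fun g => IsCGraph C g ∧ ∀ s ∉ C, g s = s) (Classical.decPred _) Finset.univ

/-- `G_{s,t}(C)`: the `C`-graphs along which `s` leads to `t`. -/
noncomputable def GsetLead (C : Finset S) (s t : S) : Finset (S → S) :=
  @Finset.filter _ (fun g => LeadsTo C g s t) (Classical.decPred _) (Gset C)

/-- `g` is an `η`-maximal `C`-graph under `q`: `p(g) ≥ η · max_{g' ∈ G(C)} p(g')`. -/
def IsMaximal (q : Matrix S S ℝ) (C : Finset S) (η : ℝ) (g : S → S) : Prop :=
  IsCGraph C g ∧ ∀ g', IsCGraph C g' → η * wt q C g' ≤ wt q C g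

/-- `H = G^β(C) ∪ Ĝ^β(C)` as a finset of canonical representatives. -/
noncomputable def Hset (q qh : Matrix S S ℝ) (C : Finset S) (β : ℝ) : Finset (S → S) :=
  @Finset.filter _ (fun g => IsMaximal q C β g ∨ IsMaximal qh C β g)
    (Classical.decPred _) (Gset C)

/-- The mixing hypothesis with parameter `a` on `S₁`: for all `s,t ∈ S₁`, the probability
that the chain started at `s`, from its first step onward, reaches `t` before reaching any
state of `S \ S₁`, is at least `a`. -/
def Mixing (q : Matrix S S ℝ) (S1 : Finset S) (a : ℝ) : Prop :=
  ∀ s ∈ S1, ∀ t ∈ S1,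
    a ≤ q s t + ∑ u ∈ S1.erase t, q s u * exitProb q (S1.erase t) u t

/-- `R` is a recurrent class for `q`. -/
def IsRecClass (q : Matrix S S ℝ) (R : Finset S) : Prop :=
  (∀ s ∈ R, ∑ t ∈ Rᶜ, q s t = 0) ∧
    ∀ s ∈ R, ∀ t ∈ R, ∃ n : ℕ, 1 ≤ n ∧ 0 < (q ^ n) s t

/-- There is an edge from `s` to `t` in the transition graph of `q`. -/
def Edge (q : Matrix S S ℝ) (s t : S) : Prop := 0 < q s t

lemma pow_entry_nonneg {q : Matrix S S ℝ} (hq : ∀ s t, 0 ≤ q s t) (n : ℕ) (s t : S) :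
    0 ≤ (q ^ n) s t := by
  induction n generalizing s t with
  | zero => rw [pow_zero, Matrix.one_apply]; split_ifs <;> norm_num
  | succ n ih =>
    rw [pow_succ, Matrix.mul_apply]
    exact sum_nonneg fun u _ => mul_nonneg (ih s u) (hq u t)

lemma exists_pow_pos_of_transGen {q : Matrix S S ℝ} (hq : ∀ s t, 0 ≤ q s t) {s t : S}
    (h : Relation.TransGen (Edge q) s t) : ∃ n : ℕ, 1 ≤ n ∧ 0 < (q ^ n) s t := by
  induction h with
  | single h => exact ⟨1, le_rfl, (pow_one q).symm ▸ h⟩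
  | @tail u v _ huv ih =>
    obtain ⟨n, -, hn⟩ := ih
    refine ⟨n + 1, by omega, ?_⟩
    rw [pow_succ, Matrix.mul_apply]
    exact sum_pos' (fun w _ => mul_nonneg (pow_entry_nonneg hq n s w) (hq w v))
      ⟨u, mem_univ u, mul_pos hn huv⟩

lemma reflTransGen_of_pow_pos {q : Matrix S S ℝ} (hq : ∀ s t, 0 ≤ q s t) {n : ℕ} {s t : S}
    (h : 0 < (q ^ n) s t) : Relation.ReflTransGen (Edge q) s t := by
  induction n generalizing t with
  | zero =>
    rw [pow_zero, Matrix.one_apply] at h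
    split_ifs at h with hst
    · rw [hst]
    · exact absurd h (lt_irrefl 0)
  | succ n ih =>
    rw [pow_succ, Matrix.mul_apply] at h
    obtain ⟨u, -, hu⟩ := exists_lt_of_sum_lt (s := univ) (f := fun _ : S => (0 : ℝ))
      (g := fun u => (q ^ n) s u * q u t) (by simpa using h)
    have h1 := pos_of_mul_pos_left hu (hq u t)
    have h2 := pos_of_mul_pos_right hu (pow_entry_nonneg hq n s u)
    exact (ih h1).tail h2

lemma IsIrreducible.reachable {q : Matrix S S ℝ} (hirr : IsIrreducible q)
    (hq : ∀ s t, 0 ≤ q s t) (s t : S) : Relation.ReflTransGen (Edge q) s t := by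
  obtain ⟨n, -, hn⟩ := hirr s t
  exact reflTransGen_of_pow_pos hq hn

lemma IsIrreducible.exists_edge_out {q : Matrix S S ℝ} (hirr : IsIrreducible q)
    (hq : ∀ s t, 0 ≤ q s t) {C : Finset S} (hC : C.Nonempty) (hCu : C ≠ univ) :
    ∃ s ∈ C, ∃ t ∉ C, 0 < q s t := by
  by_contra! h
  obtain ⟨s, hs⟩ := hC
  refine hCu (eq_univ_of_forall fun t => ?_)
  induction hirr.reachable hq s t with
  | refl => exact hs
  | tail _ huv ih => exact by_contra fun hv => (h _ ih _ hv).not_gt huv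

lemma IsStationary.pos {q : Matrix S S ℝ} {μ : S → ℝ} (hμ : IsStationary q μ)
    (hq : ∀ s t, 0 ≤ q s t) (hirr : IsIrreducible q) (t : S) : 0 < μ t := by
  obtain ⟨s, -, hs⟩ := exists_lt_of_sum_lt (s := univ) (f := fun _ : S => (0 : ℝ)) (g := μ)
    (by simp [hμ.2.1])
  induction hirr.reachable hq s t with
  | refl => exact hs
  | @tail u v _ huv ih =>
    rw [← hμ.2.2 v]
    exact sum_pos' (fun w _ => mul_nonneg (hμ.1 w) (hq w v)) ⟨u, mem_univ u, mul_pos ih huv⟩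

/-- The stationary flow out of `C`. -/
def outflow (q : Matrix S S ℝ) (μ : S → ℝ) (C : Finset S) : ℝ :=
  ∑ s ∈ C, μ s * ∑ t ∈ Cᶜ, q s t

lemma outflow_pos {q : Matrix S S ℝ} {μ : S → ℝ} (hq : ∀ s t, 0 ≤ q s t)
    (hirr : IsIrreducible q) (hμ : IsStationary q μ) {C : Finset S} (hC : C.Nonempty)
    (hCu : C ≠ univ) : 0 < outflow q μ C := by
  obtain ⟨s, hs, t, ht, hst⟩ := hirr.exists_edge_out hq hC hCu
  refine sum_pos' (fun u _ => mul_nonneg (hμ.1 u) (sum_nonneg fun v _ => hq u v))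
    ⟨s, hs, mul_pos (hμ.pos hq hirr s) ?_⟩
  exact sum_pos' (fun v _ => hq s v) ⟨t, mem_compl.2 ht, hst⟩

lemma zeta1_set_finite (q : Matrix S S ℝ) (μ : S → ℝ) (S1 : Finset S) :
    {x : ℝ | ∃ C : Finset S, C.Nonempty ∧ C ⊂ S1 ∧
      x = ∑ s ∈ C, μ s * ∑ t ∈ Cᶜ, q s t}.Finite := by
  refine (Set.finite_range (outflow q μ)).subset ?_
  rintro x ⟨C, -, -, rfl⟩
  exact ⟨C, rfl⟩

lemma zeta1_le_outflow (q : Matrix S S ℝ) (μ : S → ℝ) {S1 C : Finset S}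
    (hC : C.Nonempty) (hCS : C ⊂ S1) : zeta1 q μ S1 ≤ outflow q μ C :=
  csInf_le (zeta1_set_finite q μ S1).bddBelow ⟨C, hC, hCS, rfl⟩

lemma zeta1_pos {q : Matrix S S ℝ} {μ : S → ℝ} (hq : ∀ s t, 0 ≤ q s t)
    (hirr : IsIrreducible q) (hμ : IsStationary q μ) {S1 : Finset S} (hS1 : 1 < S1.card) :
    0 < zeta1 q μ S1 := by
  obtain ⟨s, hs, t, ht, hst⟩ := one_lt_card.1 hS1
  have hss : {s} ⊂ S1 := (ssubset_iff_of_subset (singleton_subset_iff.2 hs)).2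
    ⟨t, ht, by simpa using hst.symm⟩
  have attained := fun hne => Set.Nonempty.csInf_mem hne (zeta1_set_finite q μ S1)
  obtain ⟨C, hC, hCS, h⟩ := attained ⟨_, {s}, singleton_nonempty s, hss, rfl⟩
  rw [zeta1, h]
  exact outflow_pos hq hirr hμ hC (fun hu => by simpa [hu] using hCS.2)

/-- The stationary flow into `C` equals the flow out of `C`. -/
lemma IsStationary.sum_inflow {q : Matrix S S ℝ} {μ : S → ℝ} (hq : IsTransition q)
    (hμ : IsStationary q μ) (C : Finset S) :
    ∑ v ∈ C, ∑ u ∈ Cᶜ, μ u * q u v = outflow q μ C := by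
  have h1 : ∀ v, ∑ u ∈ Cᶜ, μ u * q u v = μ v - ∑ u ∈ C, μ u * q u v := fun v => by
    rw [← hμ.2.2 v, ← sum_add_sum_compl C]; ring
  have h2 : ∀ u, ∑ t ∈ Cᶜ, q u t = 1 - ∑ t ∈ C, q u t := fun u => by
    rw [← hq.2 u, ← sum_add_sum_compl C]; ring
  simp only [outflow, h1, h2, mul_sub, sum_sub_distrib, mul_one, mul_sum]
  rw [sum_comm]

/-- The probability of exiting `B` through `t` after exactly `n` further steps inside `B`. -/
def exitTerm (q : Matrix S S ℝ) (B : Finset S) (t : S) (n : ℕ) (s : S) : ℝ :=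
  ∑ u ∈ B, ((subMat q B ^ n : Matrix S S ℝ) s u) * q u t

lemma subMat_nonneg {T : Type*} [DecidableEq T] {q : Matrix T T ℝ}
    (hq : ∀ s t, 0 ≤ q s t) (B : Finset T) (u v : T) :
    0 ≤ subMat q B u v := by
  unfold subMat; split_ifs; exacts [hq u v, le_rfl]

lemma exitTerm_nonneg {q : Matrix S S ℝ} (hq : ∀ s t, 0 ≤ q s t) (B : Finset S) (t : S)
    (n : ℕ) (s : S) : 0 ≤ exitTerm q B t n s :=
  sum_nonneg fun u _ => mul_nonneg (pow_entry_nonneg (subMat_nonneg hq B) n s u) (hq u t)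

lemma exitTerm_zero (q : Matrix S S ℝ) {B : Finset S} (t : S) {s : S} (hs : s ∈ B) :
    exitTerm q B t 0 s = q s t := by
  simp [exitTerm, Matrix.one_apply, hs]

lemma exitTerm_succ (q : Matrix S S ℝ) {B : Finset S} (t : S) (n : ℕ) {s : S} (hs : s ∈ B) :
    exitTerm q B t (n + 1) s = ∑ v ∈ B, q s v * exitTerm q B t n v := by
  have h : ∀ u, (subMat q B ^ (n + 1) : Matrix S S ℝ) s u
      = ∑ v ∈ B, q s v * (subMat q B ^ n : Matrix S S ℝ) v u := fun u => by
    rw [pow_succ', Matrix.mul_apply, ← sum_subset (subset_univ B)]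
    · exact sum_congr rfl fun v hv => by simp [subMat, hs, hv]
    · intro v _ hv; simp [subMat, hv]
  simp only [exitTerm, h, sum_mul, mul_sum]
  rw [sum_comm]
  simp only [mul_assoc]

lemma sum_exitTerm_le_one {q : Matrix S S ℝ} (hq : IsTransition q) {B : Finset S} {t : S}
    (ht : t ∉ B) (N : ℕ) {s : S} (hs : s ∈ B) : ∑ n ∈ range N, exitTerm q B t n s ≤ 1 := by
  induction N generalizing s with
  | zero => simp
  | succ N ih =>
    rw [sum_range_succ', exitTerm_zero q t hs]
    calc ∑ n ∈ range N, exitTerm q B t (n + 1) s + q s t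
        = ∑ v ∈ B, q s v * ∑ n ∈ range N, exitTerm q B t n v + q s t := by
          simp only [exitTerm_succ q t _ hs, mul_sum]
          rw [sum_comm]
      _ ≤ ∑ v ∈ B, q s v + q s t := by
          gcongr with v hv
          exact mul_le_of_le_one_right (hq.1 s v) (ih hv)
      _ = ∑ v ∈ insert t B, q s v := by rw [sum_insert ht, add_comm]
      _ ≤ ∑ v, q s v := sum_le_univ_sum_of_nonneg (hq.1 s)
      _ = 1 := hq.2 s

lemma exitProb_nonneg {q : Matrix S S ℝ} (hq : ∀ s t, 0 ≤ q s t) (B : Finset S) (s t : S) :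
    0 ≤ exitProb q B s t :=
  tsum_nonneg fun n => exitTerm_nonneg hq B t n s

lemma exitProb_le_one {q : Matrix S S ℝ} (hq : IsTransition q) {B : Finset S} {s t : S}
    (ht : t ∉ B) (hs : s ∈ B) : exitProb q B s t ≤ 1 :=
  Real.tsum_le_of_sum_range_le (fun n => exitTerm_nonneg hq.1 B t n s)
    fun N => sum_exitTerm_le_one hq ht N hs

lemma summable_exitTerm {q : Matrix S S ℝ} (hq : IsTransition q) {B : Finset S} {s t : S}
    (ht : t ∉ B) (hs : s ∈ B) : Summable fun n => exitTerm q B t n s :=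
  summable_of_sum_range_le (fun n => exitTerm_nonneg hq.1 B t n s)
    fun N => sum_exitTerm_le_one hq ht N hs

/-- First-step decomposition of the exit distribution. -/
lemma exitProb_eq {q : Matrix S S ℝ} (hq : IsTransition q) {B : Finset S} {s t : S}
    (ht : t ∉ B) (hs : s ∈ B) :
    exitProb q B s t = q s t + ∑ v ∈ B, q s v * exitProb q B v t := by
  change ∑' n, exitTerm q B t n s = q s t + ∑ v ∈ B, q s v * ∑' n, exitTerm q B t n v
  rw [(summable_exitTerm hq ht hs).tsum_eq_zero_add, exitTerm_zero q t hs]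
  simp only [exitTerm_succ q t _ hs]
  rw [Summable.tsum_finsetSum fun v hv => (summable_exitTerm hq ht hv).mul_left (q s v)]
  simp only [tsum_mul_left]

/-- If `h` is a `[0,1]`-valued function with `h ≥ a` on `C`, vanishing off `S₁`, and harmonic on
`C`, then a share at least `a` of the stationary flow out of `C` goes to `S₁ \ C`. -/
lemma mul_outflow_le_of_harmonic {q : Matrix S S ℝ} {μ : S → ℝ} (hq : IsTransition q)
    (hμ : IsStationary q μ) {S1 C : Finset S} (hCS : C ⊆ S1) {a : ℝ} {h : S → ℝ}
    (h1 : ∀ v, h v ≤ 1) (hoff : ∀ v ∉ S1, h v = 0) (hC : ∀ v ∈ C, a ≤ h v)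
    (hharm : ∀ u ∈ C, h u = ∑ v, q u v * h v) :
    a * outflow q μ C ≤ ∑ v ∈ S1 \ C, ∑ u ∈ C, μ u * q u v := by
  have split : ∑ u ∈ C, μ u * h u = ∑ v ∈ C, h v * ∑ u ∈ C, μ u * q u v
      + ∑ v ∈ S1 \ C, h v * ∑ u ∈ C, μ u * q u v := by
    calc ∑ u ∈ C, μ u * h u = ∑ u ∈ C, ∑ v, h v * (μ u * q u v) :=
          sum_congr rfl fun u hu => by
            rw [hharm u hu, mul_sum]; exact sum_congr rfl fun v _ => by ring
      _ = ∑ v, h v * ∑ u ∈ C, μ u * q u v := by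
          rw [sum_comm]; simp only [mul_sum]
      _ = ∑ v ∈ S1, h v * ∑ u ∈ C, μ u * q u v :=
          (sum_subset (subset_univ S1) fun v _ hv => by rw [hoff v hv, zero_mul]).symm
      _ = _ := by rw [add_comm, sum_sdiff hCS]
  have balance : ∑ u ∈ C, μ u * h u = ∑ v ∈ C, h v * ∑ u ∈ C, μ u * q u v
      + ∑ v ∈ C, h v * ∑ u ∈ Cᶜ, μ u * q u v := by
    rw [← sum_add_distrib]
    refine sum_congr rfl fun v _ => ?_
    rw [← mul_add, sum_add_sum_compl, hμ.2.2 v, mul_comm]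
  have flow_nonneg : ∀ (A : Finset S) v, 0 ≤ ∑ u ∈ A, μ u * q u v := fun A v =>
    sum_nonneg fun u _ => mul_nonneg (hμ.1 u) (hq.1 u v)
  calc a * outflow q μ C = ∑ v ∈ C, a * ∑ u ∈ Cᶜ, μ u * q u v := by
        rw [← hμ.sum_inflow hq C, mul_sum]
    _ ≤ ∑ v ∈ C, h v * ∑ u ∈ Cᶜ, μ u * q u v :=
        sum_le_sum fun v hv => mul_le_mul_of_nonneg_right (hC v hv) (flow_nonneg _ v)
    _ = ∑ v ∈ S1 \ C, h v * ∑ u ∈ C, μ u * q u v := by linarith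
    _ ≤ ∑ v ∈ S1 \ C, ∑ u ∈ C, μ u * q u v :=
        sum_le_sum fun v _ => mul_le_of_le_one_left (flow_nonneg _ v) (h1 v)

lemma Mixing.mul_outflow_le {q : Matrix S S ℝ} {μ : S → ℝ} (hq : IsTransition q)
    (hμ : IsStationary q μ) {S1 C : Finset S} {a : ℝ} (hmix : Mixing q S1 a) (hCS : C ⊂ S1) :
    a * outflow q μ C ≤ ∑ v ∈ S1 \ C, ∑ u ∈ C, μ u * q u v := by
  obtain ⟨t, htS, htC⟩ := exists_of_ssubset hCS
  have htB : t ∉ S1.erase t := notMem_erase t S1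
  have hCB : ∀ u ∈ C, u ∈ S1.erase t := fun u hu =>
    mem_erase.2 ⟨fun hut => htC (hut ▸ hu), hCS.1 hu⟩
  let h : S → ℝ := fun v =>
    if v = t then 1 else if v ∈ S1.erase t then exitProb q (S1.erase t) v t else 0
  have ht : h t = 1 := if_pos rfl
  have hB : ∀ v ∈ S1.erase t, h v = exitProb q (S1.erase t) v t := fun v hv =>
    (if_neg (ne_of_mem_erase hv)).trans (if_pos hv)
  have hoff : ∀ v ∉ S1, h v = 0 := fun v hv =>
    (if_neg (ne_of_mem_of_not_mem htS hv).symm).trans (if_neg (mt mem_of_mem_erase hv))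
  refine mul_outflow_le_of_harmonic hq hμ hCS.1 (h := h) (fun v => ?_) hoff (fun v hv => ?_)
    fun u hu => ?_
  · change ite _ _ _ ≤ _
    split_ifs with _ hv
    exacts [le_rfl, exitProb_le_one hq htB hv, zero_le_one]
  · rw [hB v (hCB v hv), exitProb_eq hq htB (hCB v hv)]
    exact hmix v (hCS.1 hv) t htS
  · rw [hB u (hCB u hu), exitProb_eq hq htB (hCB u hu),
      ← sum_subset (subset_univ S1) fun v _ hv => by rw [hoff v hv, mul_zero],
      ← add_sum_erase S1 _ htS, ht, mul_one]
    exact congrArg _ (sum_congr rfl fun v hv => by rw [hB v hv])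

lemma Mixing.le_one {q : Matrix S S ℝ} (hq : IsTransition q) {S1 : Finset S} {a : ℝ}
    (hmix : Mixing q S1 a) (hS1 : S1.Nonempty) : a ≤ 1 := by
  obtain ⟨s, hs⟩ := hS1
  have hsB : s ∉ S1.erase s := notMem_erase s S1
  calc a ≤ q s s + ∑ u ∈ S1.erase s, q s u * exitProb q (S1.erase s) u s := hmix s hs s hs
    _ ≤ q s s + ∑ u ∈ S1.erase s, q s u := by
        gcongr with u hu
        exact mul_le_of_le_one_right (hq.1 s u) (exitProb_le_one hq hsB hu)
    _ = ∑ u ∈ S1, q s u := add_sum_erase S1 _ hs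
    _ ≤ ∑ u, q s u := sum_le_univ_sum_of_nonneg (hq.1 s)
    _ = 1 := hq.2 s

lemma one_le_Lconst {T : Type*} [Fintype T] (hcard : 2 ≤ Fintype.card T) : 1 ≤ Lconst T := by
  have h : (Fintype.card T).choose 1 * 1 ^ Fintype.card T ≤ Lconst T :=
    single_le_sum (f := fun n => (Fintype.card T).choose n * n ^ Fintype.card T)
      (fun _ _ => Nat.zero_le _) (mem_Ico.2 ⟨le_rfl, hcard⟩)
  simp only [Nat.choose_one_right, one_pow, mul_one] at h
  omega

lemma threshold_mul_card_sq_lt {n : ℕ} (hn : 2 ≤ n) {L a β ε : ℝ} (hL : 1 ≤ L)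
    (ha0 : 0 < a) (ha1 : a ≤ 1) (hβ0 : 0 < β) (hβ1 : β < 1)
    (hε : ε < 1 / 2 * (a / L) ^ n * (β * (1 - β) / (L * (n : ℝ) ^ 4))) :
    ε * (n : ℝ) ^ 2 < a := by
  have hL0 : 0 < L := by linarith
  have hn1 : (1 : ℝ) ≤ n := by exact_mod_cast (by omega : 1 ≤ n)
  have haL : a / L ≤ a := div_le_self ha0.le hL
  have hpow : (a / L) ^ n ≤ a :=
    (pow_le_of_le_one (by positivity) (haL.trans ha1) (by omega)).trans haL
  have hfrac : β * (1 - β) / (L * (n : ℝ) ^ 4) ≤ 1 / (n : ℝ) ^ 4 := by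
    refine div_le_div₀ zero_le_one (by nlinarith) (by positivity) ?_
    exact le_mul_of_one_le_left (by positivity) hL
  have h0 : 0 ≤ β * (1 - β) / (L * (n : ℝ) ^ 4) :=
    div_nonneg (mul_nonneg hβ0.le (by linarith)) (by positivity)
  calc ε * (n : ℝ) ^ 2
      < 1 / 2 * (a / L) ^ n * (β * (1 - β) / (L * (n : ℝ) ^ 4)) * (n : ℝ) ^ 2 := by gcongr
    _ ≤ 1 / 2 * a * (1 / (n : ℝ) ^ 4) * (n : ℝ) ^ 2 := by gcongr
    _ = 1 / 2 * a * (1 / (n : ℝ) ^ 2) := by field_simp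
    _ ≤ 1 / 2 * a * 1 := by
        gcongr
        exact div_le_one_of_le₀ (one_le_pow₀ hn1) (by positivity)
    _ ≤ a := by linarith

/-- Edges of `q` carrying at least the threshold flow survive in any close perturbation. -/
lemma IsClose.flow_lt {T : Type*} {q qh : Matrix T T ℝ} {μ : T → ℝ} {z ε β : ℝ}
    (hclose : IsClose q qh μ z ε β) (hεz : 0 < ε * z) (hβ : β < 1) (hq : ∀ s t, 0 ≤ q s t)
    {s t : T} (hst : qh s t ≤ 0) : μ s * q s t < ε * z := by
  by_contra! h
  have hpos : 0 < q s t := (hq s t).lt_of_ne fun h0 => by rw [← h0] at h; linarith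
  have := (abs_le.1 (hclose s t (Or.inl h))).1
  nlinarith

/-- A set containing a state of `S₁` and closed under a perturbation contains all of `S₁`. -/
lemma subset_of_closed {q qh : Matrix S S ℝ} {μ : S → ℝ} {S1 D : Finset S} {β ε a : ℝ}
    (hS1 : 1 < S1.card) (hβ : β < 1) (hε0 : 0 < ε)
    (hε1 : ε * (Fintype.card S : ℝ) ^ 2 < a)
    (hq : IsTransition q) (hqirr : IsIrreducible q) (hμ : IsStationary q μ)
    (hmix : Mixing q S1 a) (hclose : IsClose q qh μ (zeta1 q μ S1) ε β)
    (hD : ∀ s ∈ D, ∀ t ∉ D, qh s t ≤ 0) (hne : (S1 ∩ D).Nonempty) : S1 ⊆ D := by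
  by_contra hnot
  have hCS : S1 ∩ D ⊂ S1 :=
    inter_subset_left.ssubset_of_ne fun h => hnot (inter_eq_left.1 h)
  have hz := zeta1_pos hq.1 hqirr hμ hS1
  have hεz : 0 < ε * zeta1 q μ S1 := mul_pos hε0 hz
  have ha : 0 ≤ a := (by positivity : 0 ≤ ε * (Fintype.card S : ℝ) ^ 2).trans hε1.le
  have key : a * zeta1 q μ S1 ≤ ε * (Fintype.card S : ℝ) ^ 2 * zeta1 q μ S1 :=
    calc a * zeta1 q μ S1 ≤ a * outflow q μ (S1 ∩ D) := by
          gcongr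
          exact zeta1_le_outflow q μ hne hCS
      _ ≤ ∑ v ∈ S1 \ (S1 ∩ D), ∑ u ∈ S1 ∩ D, μ u * q u v := hmix.mul_outflow_le hq hμ hCS
      _ ≤ ∑ v ∈ S1 \ (S1 ∩ D), ∑ u ∈ S1 ∩ D, ε * zeta1 q μ S1 := by
          refine sum_le_sum fun v hv => sum_le_sum fun u hu => ?_
          have hvD : v ∉ D := by grind
          exact (hclose.flow_lt hεz hβ hq.1 (hD u (mem_of_mem_inter_right hu) v hvD)).le
      _ ≤ ∑ v : S, ∑ u : S, ε * zeta1 q μ S1 := by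
          simp only [sum_const, nsmul_eq_mul]
          gcongr <;> exact subset_univ _
      _ = ε * (Fintype.card S : ℝ) ^ 2 * zeta1 q μ S1 := by
          simp only [sum_const, nsmul_eq_mul, card_univ]; ring
  exact absurd (le_of_mul_le_mul_right key hz) hε1.not_ge

/-- under the mixing hypothesis on `S₁`, if `q̂` is `(ε,β)`-close to `q` on `S₁`
and coincides with `q` outside `S₁`, then all states of `S₁` belong to one recurrent class
of `q̂`. -/
theorem perturbed_recurrent_class
    (hcard : 2 ≤ Fintype.card S)
    (q qh : Matrix S S ℝ) (μ : S → ℝ) (S1 : Finset S) (hS1 : 1 < S1.card)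
    (β ε a : ℝ)
    (hβ0 : 0 < β) (hβ1 : β < 1 / 2 ^ Fintype.card S) (ha : 0 < a)
    (hε0 : 0 < ε)
    (hε1 : ε < 1 / 2 * (a / (Lconst S : ℝ)) ^ Fintype.card S *
        (β * (1 - β) / ((Lconst S : ℝ) * (Fintype.card S : ℝ) ^ 4)))
    (hq : IsTransition q) (hqirr : IsIrreducible q) (hμ : IsStationary q μ)
    (hmix : Mixing q S1 a)
    (hqh : IsTransition qh)
    (hclose : IsClose q qh μ (zeta1 q μ S1) ε β)
    (hcoin : ∀ s ∉ S1, ∀ t, qh s t = q s t) :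
    ∃ R : Finset S, IsRecClass qh R ∧ S1 ⊆ R := by
  have hβ : β < 1 := hβ1.trans_le (div_le_one_of_le₀ (one_le_pow₀ one_le_two) (by positivity))
  have hS1ne : S1.Nonempty := card_pos.1 (by omega)
  have hε : ε * (Fintype.card S : ℝ) ^ 2 < a :=
    threshold_mul_card_sq_lt hcard (by exact_mod_cast one_le_Lconst hcard) ha
      (hmix.le_one hq hS1ne) hβ0 hβ hε1
  classical
  have reach : ∀ s ∈ S1, ∀ t ∈ S1, Relation.ReflTransGen (Edge qh) s t := by
    intro s hs t ht
    let D : Finset S := univ.filter fun v => Relation.ReflTransGen (Edge qh) s v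
    have hD : ∀ u ∈ D, ∀ v ∉ D, qh u v ≤ 0 := fun u hu v hv => by
      by_contra! h
      exact hv (mem_filter.2 ⟨mem_univ v, (mem_filter.1 hu).2.tail h⟩)
    have hsD : s ∈ D := mem_filter.2 ⟨mem_univ s, .refl⟩
    exact (mem_filter.1 (subset_of_closed hS1 hβ hε0 hε hq hqirr hμ hmix hclose hD
      ⟨s, mem_inter.2 ⟨hs, hsD⟩⟩ ht)).2
  obtain ⟨s₀, hs₀⟩ := hS1ne
  have back : ∀ x, Relation.ReflTransGen (Edge qh) x s₀ := by
    intro x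
    induction hqirr.reachable hq.1 x s₀ using Relation.ReflTransGen.head_induction_on with
    | refl => exact .refl
    | @head u v huv _ ih =>
      by_cases hu : u ∈ S1
      · exact reach u hu s₀ hs₀
      · refine .head ?_ ih
        rw [Edge, hcoin u hu v]
        exact huv
  refine ⟨univ.filter fun v => Relation.ReflTransGen (Edge qh) s₀ v, ⟨fun s hs => ?_,
    fun s _ t ht => ?_⟩, fun t ht => mem_filter.2 ⟨mem_univ t, reach s₀ hs₀ t ht⟩⟩
  · refine sum_eq_zero fun t ht => le_antisymm ?_ (hqh.1 s t)
    by_contra! h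
    exact mem_compl.1 ht (mem_filter.2 ⟨mem_univ t, (mem_filter.1 hs).2.tail h⟩)
  · obtain ⟨z, -, hz⟩ := exists_lt_of_sum_lt (s := univ) (f := fun _ : S => (0 : ℝ))
      (g := qh s) (by simp [hqh.2 s])
    exact exists_pow_pos_of_transGen hqh.1
      (Relation.TransGen.head' hz ((back z).trans (mem_filter.1 ht).2))

end PerturbedMC
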